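/- Assume Hypothesis A and that φ is smooth with ∫_{ℝ³} |k|^{2n} φ̂(k) dk < ∞ for all n. Consider the discrete filament model: continuously differentiable curves x_α : [0,T] → ℝ³ (α = 1,…,N, indices taken cyclically mod N), with ξ_α(t) = x_{α+1}(t) − x_α(t), satisfying ẋ_α(t) = u_t(x_α(t)) where u_t(x) = ∑_{α=1}^N ∇φ(x − x_α(t)) ∧ ξ_α(t). Let H(t), A(t) be the energy and quadratic variation of the configuration (x_α(t), ξ_α(t)). Then there exist constants c₁, c₂ > 0 depending only on φ (not on N, T, or the solution) such that for all t ∈ [0,T], |dH/dt| ≤ c₁ H(t) A(t) + c₂ H(t)^{1/2} A(t). -/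

import Mathlib

noncomputable section
open MeasureTheory Real Set

/-- Three-dimensional Euclidean space. -/
abbrev E3 := EuclideanSpace ℝ (Fin 3)

/-- The cross product on `ℝ³`. -/
def cross3 (a b : E3) : E3 := WithLp.toLp 2 (crossProduct a b)

/-- The Fourier transform `∫_{ℝ³} e^{i⟨k,x⟩} f(x) dx` of `f : ℝ³ → ℝ`, as a complex number. -/
def fourierInt (f : E3 → ℝ) (k : E3) : ℂ :=
  ∫ x : E3, Complex.exp (Complex.I * ((inner ℝ k x : ℝ) : ℂ)) * (f x : ℂ)

/-- Hypothesis A: `φ` is even, continuous, integrable, its Fourier transform is the real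
nonnegative function `φhat`, and `φhat` satisfies the moment condition (A.4). -/
structure HypA (φ : E3 → ℝ) (φhat : E3 → ℝ) : Prop where
  even : ∀ x, φ (-x) = φ x
  cont : Continuous φ
  integrable : Integrable φ
  fourier_eq : ∀ k, (φhat k : ℂ) = fourierInt φ k
  nonneg : ∀ k, 0 ≤ φhat k
  moment : Integrable (fun k : E3 => (1 + ‖k‖ ^ 2) ^ 2 * φhat k)

/-- The velocity field `u(x) = ∑_α ∇φ(x − x_α) ∧ ξ_α` of a discrete vorticity
configuration `(x_α, ξ_α)`. -/
def discVel (φ : E3 → ℝ) {N : ℕ} (x ξ : Fin N → E3) (p : E3) : E3 :=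
  ∑ α, cross3 (gradient φ (p - x α)) (ξ α)

/-- The energy `H = (1/2) ∑_{α,β} φ(x_α − x_β) ⟨ξ_α, ξ_β⟩`. -/
def discEnergy (φ : E3 → ℝ) {N : ℕ} (x ξ : Fin N → E3) : ℝ :=
  (1 / 2) * ∑ α, ∑ β, φ (x α - x β) * (inner ℝ (ξ α) (ξ β) : ℝ)

/-- The length `L = ∑_α |ξ_α|` of the configuration. -/
def discLength {N : ℕ} (ξ : Fin N → E3) : ℝ := ∑ α, ‖ξ α‖

/-- The quadratic variation `A = ∑_α |ξ_α|²` of the configuration. -/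
def discQuad {N : ℕ} (ξ : Fin N → E3) : ℝ := ∑ α, ‖ξ α‖ ^ 2

/-- The field `Ψ(x) = ∑_α φ(x − x_α) ξ_α`. -/
def discPsi (φ : E3 → ℝ) {N : ℕ} (x ξ : Fin N → E3) (p : E3) : E3 :=
  ∑ α, φ (p - x α) • ξ α

/-- The curl of a vector field on `ℝ³`, computed with `fderiv`. -/
def curl3 (F : E3 → E3) (p : E3) : E3 :=
  !₂[fderiv ℝ F p (EuclideanSpace.single 1 1) 2 - fderiv ℝ F p (EuclideanSpace.single 2 1) 1,
    fderiv ℝ F p (EuclideanSpace.single 2 1) 0 - fderiv ℝ F p (EuclideanSpace.single 0 1) 2,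
    fderiv ℝ F p (EuclideanSpace.single 0 1) 1 - fderiv ℝ F p (EuclideanSpace.single 1 1) 0]

/-- The function `Φ(x) = ⟨Ψ(x), curl Ψ(x)⟩`. -/
def discPhi (φ : E3 → ℝ) {N : ℕ} (x ξ : Fin N → E3) (p : E3) : ℝ :=
  inner ℝ (discPsi φ x ξ p) (curl3 (discPsi φ x ξ) p)

/-! ### The spectral measure of `φ` -/

lemma HypA.fourier_ofReal {φ φhat : E3 → ℝ} (hA : HypA φ φhat) (w : E3) :
    FourierTransform.fourier (fun x => (φ x : ℂ)) w = φhat ((-(2 * π)) • w) := by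
  rw [hA.fourier_eq, fourierInt, Real.fourier_eq']
  refine integral_congr_ae (.of_forall fun x => ?_)
  simp only [smul_eq_mul, inner_smul_left, real_inner_comm x w]
  congr 2
  push_cast
  simp only [conj_trivial]
  push_cast
  ring

/-- Fourier inversion exhibits `φ` as the cosine transform of a finite measure all of whose
moments are finite. -/
lemma exists_spectralMeasure {φ φhat : E3 → ℝ} (hA : HypA φ φhat)
    (hmom : ∀ n : ℕ, Integrable (fun k : E3 => ‖k‖ ^ (2 * n) * φhat k)) :
    ∃ μ : Measure E3, IsFiniteMeasure μ ∧ (∀ n : ℕ, Integrable (fun k => ‖k‖ ^ n) μ) ∧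
      ∀ x, φ x = ∫ k, cos (inner ℝ k x) ∂μ := by
  have hint : Integrable φhat := by simpa using hmom 0
  have hpi : (-(2 * π)) ≠ 0 := neg_ne_zero.2 (by positivity)
  set c : ℝ := |((-(2 * π)) ^ Module.finrank ℝ E3)⁻¹| with hc
  have hc0 : 0 ≤ c := abs_nonneg _
  have hcint : Integrable (fun k => c * φhat k) := hint.const_mul c
  have hmeas : AEMeasurable (fun k => ENNReal.ofReal (c * φhat k)) :=
    hcint.aemeasurable.ennreal_ofReal
  have htop : ∀ᵐ k : E3, ENNReal.ofReal (c * φhat k) < ⊤ := .of_forall fun _ => by simp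
  have htoReal : ∀ k, (ENNReal.ofReal (c * φhat k)).toReal = c * φhat k := fun k =>
    ENNReal.toReal_ofReal (mul_nonneg hc0 (hA.nonneg k))
  set μ : Measure E3 := volume.withDensity fun k => ENNReal.ofReal (c * φhat k) with hμ
  have hfin : IsFiniteMeasure μ := isFiniteMeasure_withDensity_ofReal hcint.2
  refine ⟨μ, hfin, fun n => ?_, fun x => ?_⟩
  · have heven : Integrable (fun k : E3 => 1 + ‖k‖ ^ (2 * n)) μ := by
      refine (integrable_const 1).add ?_
      rw [hμ, integrable_withDensity_iff_integrable_smul₀' hmeas htop]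
      refine ((hmom n).const_mul c).congr (.of_forall fun k => ?_)
      simp only [htoReal, smul_eq_mul]
      ring
    refine heven.mono' (by fun_prop) (.of_forall fun k => ?_)
    rw [Real.norm_of_nonneg (by positivity), mul_comm 2 n, pow_mul]
    nlinarith [sq_nonneg (‖k‖ ^ n - 1)]
  · have hF : FourierTransform.fourier (fun x => (φ x : ℂ)) =
        fun w => (φhat ((-(2 * π)) • w) : ℂ) := funext hA.fourier_ofReal
    have hinv := congrFun (Continuous.fourierInv_fourier_eq (f := fun x => (φ x : ℂ))
      (Complex.continuous_ofReal.comp hA.cont) hA.integrable.ofReal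
      (by rw [hF]; exact ((integrable_comp_smul_iff volume _ hpi).2 hint).ofReal)) x
    rw [hF, Real.fourierInv_eq'] at hinv
    have hre := congrArg Complex.re hinv
    set G : E3 → ℂ := fun k => Complex.exp ((-(inner ℝ k x : ℝ) : ℝ) * Complex.I) * φhat k with hG
    have hcomp : ∀ v : E3, Complex.exp ((2 * π * inner ℝ v x : ℝ) * Complex.I) •
        (φhat ((-(2 * π)) • v) : ℂ) = G ((-(2 * π)) • v) := by
      intro v
      simp only [hG, smul_eq_mul, inner_smul_left, conj_trivial]
      congr 4
      ring
    have hGint : Integrable G := by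
      refine (hint.ofReal (𝕜 := ℂ)).bdd_mul (c := 1) (by fun_prop) (.of_forall fun k => ?_)
      rw [Complex.norm_exp_ofReal_mul_I]
    simp_rw [hcomp] at hre
    rw [Measure.integral_comp_smul volume G, Complex.smul_re, Complex.ofReal_re,
      ← RCLike.re_eq_complex_re, ← integral_re hGint] at hre
    rw [← hre, hμ, integral_withDensity_eq_integral_toReal_smul₀ hmeas htop, smul_eq_mul,
      ← integral_const_mul]
    refine integral_congr_ae (.of_forall fun k => ?_)
    simp only [htoReal, hG, RCLike.re_eq_complex_re, Complex.re_mul_ofReal,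
      Complex.exp_ofReal_mul_I_re, cos_neg, smul_eq_mul]
    ring

lemma integrable_of_norm_le_mul_pow {F : Type*} [NormedAddCommGroup F] {μ : Measure E3}
    (hμ : ∀ n : ℕ, Integrable (fun k => ‖k‖ ^ n) μ) {f : E3 → F} (hf : Continuous f)
    (B : ℝ) (n : ℕ) (hB : ∀ k, ‖f k‖ ≤ B * ‖k‖ ^ n) : Integrable f μ :=
  ((hμ n).const_mul B).mono' hf.aestronglyMeasurable (.of_forall hB)

lemma integrable_cos_inner {μ : Measure E3}
    (hμ : ∀ n : ℕ, Integrable (fun k => ‖k‖ ^ n) μ) (x : E3) :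
    Integrable (fun k : E3 => cos (inner ℝ k x)) μ :=
  integrable_of_norm_le_mul_pow hμ (by fun_prop) 1 0 fun k => by simpa using abs_cos_le_one _

lemma integrable_sin_inner_smul {μ : Measure E3}
    (hμ : ∀ n : ℕ, Integrable (fun k => ‖k‖ ^ n) μ) (x : E3) :
    Integrable (fun k : E3 => (-sin (inner ℝ k x)) • k) μ := by
  refine integrable_of_norm_le_mul_pow hμ (by fun_prop) 1 1 fun k => ?_
  rw [norm_smul, norm_neg, pow_one]
  gcongr
  exact abs_sin_le_one _

lemma gradient_eq_integral {φ : E3 → ℝ} {μ : Measure E3}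
    (hμ : ∀ n : ℕ, Integrable (fun k => ‖k‖ ^ n) μ)
    (hφ : ∀ x, φ x = ∫ k, cos (inner ℝ k x) ∂μ) (x : E3) :
    gradient φ x = ∫ k, (-sin (inner ℝ k x)) • k ∂μ := by
  have hderiv : HasFDerivAt (fun x => ∫ k, cos (inner ℝ k x) ∂μ)
      (∫ k, (-sin (inner ℝ k x)) • innerSL ℝ k ∂μ) x := by
    refine hasFDerivAt_integral_of_dominated_of_fderiv_le
      (F' := fun x k => (-sin (inner ℝ k x)) • innerSL ℝ k)
      (bound := fun k => ‖k‖ ^ 1) Filter.univ_mem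
      (.of_forall fun y => Continuous.aestronglyMeasurable (by fun_prop))
      (integrable_cos_inner hμ x)
      (Continuous.aestronglyMeasurable (by fun_prop)) (.of_forall fun k y _ => ?_) (hμ 1)
      (.of_forall fun k y _ => ?_)
    · rw [norm_smul, norm_neg, innerSL_apply_norm, pow_one]
      exact mul_le_of_le_one_left (norm_nonneg _) (abs_sin_le_one _)
    · exact (innerSL ℝ k).hasFDerivAt.cos
  rw [← funext hφ] at hderiv
  refine HasGradientAt.gradient (hasGradientAt_iff_hasFDerivAt.2 ?_)
  have hdual : InnerProductSpace.toDual ℝ E3 (∫ k, (-sin (inner ℝ k x)) • k ∂μ) =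
      ∫ k, (-sin (inner ℝ k x)) • innerSL ℝ k ∂μ :=
    (ContinuousLinearMap.integral_comp_comm
      (InnerProductSpace.toDual ℝ E3).toContinuousLinearEquiv.toContinuousLinearMap
      (integrable_sin_inner_smul hμ x)).symm.trans (integral_congr_ae (.of_forall fun k => by ext v; simp))
  rw [hdual]
  exact hderiv

/-! ### The cross product -/

/-- The cross product with fixed second factor, as a continuous linear map. -/
def crossRight (b : E3) : E3 →L[ℝ] E3 :=
  LinearMap.toContinuousLinearMap
    { toFun := fun a => cross3 a b
      map_add' := fun a a' => by simp [cross3]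
      map_smul' := fun r a => by simp [cross3] }

@[simp] lemma crossRight_apply (a b : E3) : crossRight b a = cross3 a b := rfl

lemma cross3_smul_left (r : ℝ) (a b : E3) : cross3 (r • a) b = r • cross3 a b :=
  (crossRight b).map_smul r a

lemma cross3_smul_right (r : ℝ) (a b : E3) : cross3 a (r • b) = r • cross3 a b := by
  simp [cross3]

lemma cross3_sub_right (a b c : E3) : cross3 a (b - c) = cross3 a b - cross3 a c := by
  simp [cross3]

lemma cross3_sum_right {ι : Type*} (s : Finset ι) (a : E3) (f : ι → E3) :
    cross3 a (∑ i ∈ s, f i) = ∑ i ∈ s, cross3 a (f i) := by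
  simp [cross3]

lemma inner_cross3_cross3 (a b c d : E3) :
    inner ℝ (cross3 a b) (cross3 c d) =
      inner ℝ a c * inner ℝ b d - inner ℝ a d * inner ℝ b c := by
  simp only [cross3, cross_apply, PiLp.inner_apply, Fin.sum_univ_three, RCLike.inner_apply,
    conj_trivial, Matrix.cons_val]
  ring

lemma inner_self_cross3 (a b : E3) : inner ℝ a (cross3 a b) = 0 := by
  simp only [cross3, cross_apply, PiLp.inner_apply, Fin.sum_univ_three, RCLike.inner_apply,
    conj_trivial, Matrix.cons_val]
  ring

lemma norm_cross3_le (a b : E3) : ‖cross3 a b‖ ≤ ‖a‖ * ‖b‖ := by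
  refine abs_le_of_sq_le_sq' ?_ (by positivity) |>.2
  rw [← real_inner_self_eq_norm_sq, inner_cross3_cross3, mul_pow, real_inner_self_eq_norm_sq,
    real_inner_self_eq_norm_sq, real_inner_comm]
  nlinarith [mul_self_nonneg (inner ℝ b a : ℝ), real_inner_comm a b]

/-! ### Fourier modes of a configuration -/

/-- The real Fourier mode `∑ α, cos (θ - ⟨k, p α⟩) ξ α` of a configuration at phase `θ`. -/
def wave {N : ℕ} (p ξ : Fin N → E3) (θ : ℝ) (k : E3) : E3 :=
  ∑ α, cos (θ - inner ℝ k (p α)) • ξ α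

/-- The modulus of the complex Fourier mode `∑ α, e^{i⟨k, p α⟩} ξ α`. -/
def waveNorm {N : ℕ} (p ξ : Fin N → E3) (k : E3) : ℝ :=
  √(‖wave p ξ 0 k‖ ^ 2 + ‖wave p ξ (π / 2) k‖ ^ 2)

lemma wave_eq {N : ℕ} (p ξ : Fin N → E3) (θ : ℝ) (k : E3) :
    wave p ξ θ k = cos θ • wave p ξ 0 k + sin θ • wave p ξ (π / 2) k := by
  simp only [wave, Finset.smul_sum, ← Finset.sum_add_distrib, smul_smul, ← add_smul]
  refine Finset.sum_congr rfl fun α _ => ?_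
  rw [zero_sub, cos_neg, cos_pi_div_two_sub, cos_sub]

lemma wave_add_pi_div_two {N : ℕ} (p ξ : Fin N → E3) (θ : ℝ) (k : E3) :
    wave p ξ (θ + π / 2) k = ∑ α, (-sin (θ - inner ℝ k (p α))) • ξ α := by
  refine Finset.sum_congr rfl fun α _ => ?_
  rw [add_sub_right_comm, cos_add_pi_div_two]

lemma continuous_wave {N : ℕ} (p ξ : Fin N → E3) {θ : E3 → ℝ} (hθ : Continuous θ) :
    Continuous fun k => wave p ξ (θ k) k := by
  unfold wave
  fun_prop

lemma continuous_waveNorm {N : ℕ} (p ξ : Fin N → E3) : Continuous (waveNorm p ξ) := by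
  have h₀ := continuous_wave p ξ (θ := fun _ => 0) continuous_const
  have h₁ := continuous_wave p ξ (θ := fun _ => π / 2) continuous_const
  unfold waveNorm
  fun_prop

lemma norm_wave_le {N : ℕ} (p ξ : Fin N → E3) (θ : ℝ) (k : E3) :
    ‖wave p ξ θ k‖ ≤ discLength ξ := by
  refine (norm_sum_le _ _).trans (Finset.sum_le_sum fun α _ => ?_)
  rw [norm_smul]
  exact mul_le_of_le_one_left (norm_nonneg _) (abs_cos_le_one _)

lemma waveNorm_nonneg {N : ℕ} (p ξ : Fin N → E3) (k : E3) : 0 ≤ waveNorm p ξ k := sqrt_nonneg _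

lemma waveNorm_sq {N : ℕ} (p ξ : Fin N → E3) (k : E3) :
    waveNorm p ξ k ^ 2 = ‖wave p ξ 0 k‖ ^ 2 + ‖wave p ξ (π / 2) k‖ ^ 2 :=
  sq_sqrt (by positivity)

lemma waveNorm_sq_le {N : ℕ} (p ξ : Fin N → E3) (k : E3) :
    waveNorm p ξ k ^ 2 ≤ 2 * discLength ξ ^ 2 := by
  rw [waveNorm_sq, two_mul]
  gcongr <;> exact norm_wave_le _ _ _ _

lemma norm_smul_add_smul_wave_le {N : ℕ} (p ξ : Fin N → E3) (k : E3) (c s : ℝ) :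
    ‖c • wave p ξ 0 k + s • wave p ξ (π / 2) k‖ ≤ (|c| + |s|) * waveNorm p ξ k := by
  have h₀ : ‖wave p ξ 0 k‖ ≤ waveNorm p ξ k :=
    le_sqrt_of_sq_le (by linarith [sq_nonneg ‖wave p ξ (π / 2) k‖])
  have h₁ : ‖wave p ξ (π / 2) k‖ ≤ waveNorm p ξ k :=
    le_sqrt_of_sq_le (by linarith [sq_nonneg ‖wave p ξ 0 k‖])
  refine (norm_add_le _ _).trans ?_
  rw [norm_smul, norm_smul, add_mul, Real.norm_eq_abs, Real.norm_eq_abs]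
  gcongr

lemma abs_sin_sub_self_le (b : ℝ) : |sin b - b| ≤ 2 * b ^ 2 := by
  rw [← sq_abs b]
  rcases le_total |b| 1 with hb | hb
  · have h := sin_bound hb
    have h3 : |b ^ 3 / 6| = |b| ^ 3 / 6 := by rw [abs_div, abs_pow]; norm_num
    calc |sin b - b| = |(sin b - (b - b ^ 3 / 6)) - b ^ 3 / 6| := by ring_nf
      _ ≤ |b| ^ 5 / 100 + |b| ^ 3 / 6 := (abs_sub _ _).trans (by rw [h3]; gcongr)
      _ ≤ 2 * |b| ^ 2 := by
        have h3 : |b| ^ 3 ≤ |b| ^ 2 := pow_le_pow_of_le_one (abs_nonneg b) hb (by norm_num)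
        have h5 : |b| ^ 5 ≤ |b| ^ 2 := pow_le_pow_of_le_one (abs_nonneg b) hb (by norm_num)
        nlinarith [sq_nonneg |b|]
  · have h := abs_sin_le_abs (x := b)
    nlinarith [abs_sub (sin b) b]

lemma abs_cos_sub_one_le (b : ℝ) : |cos b - 1| ≤ b ^ 2 := by
  rw [abs_sub_comm, abs_of_nonneg (by linarith [cos_le_one b])]
  nlinarith [one_sub_sq_div_two_le_cos (x := b)]

lemma abs_mul_add_mul_le {c s x y X Y : ℝ} (hc : |c| ≤ 1) (hs : |s| ≤ 1) (hx : |x| ≤ X)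
    (hy : |y| ≤ Y) : |c * x + s * y| ≤ X + Y := by
  refine (abs_add_le _ _).trans ?_
  rw [abs_mul, abs_mul]
  have := mul_le_of_le_one_left (abs_nonneg x) hc
  have := mul_le_of_le_one_left (abs_nonneg y) hs
  linarith

lemma abs_cos_add_taylor_le (a b : ℝ) : |cos (a + b) - cos a - b * -sin a| ≤ 3 * b ^ 2 := by
  rw [show cos (a + b) - cos a - b * -sin a = cos a * (cos b - 1) + -sin a * (sin b - b) by
    rw [cos_add]; ring]
  refine (abs_mul_add_mul_le (abs_cos_le_one a) ((abs_neg _).trans_le (abs_sin_le_one a))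
    (abs_cos_sub_one_le b) (abs_sin_sub_self_le b)).trans_eq (by ring)

lemma abs_sin_add_taylor_le (a b : ℝ) : |sin (a + b) - sin a - b * cos a| ≤ 3 * b ^ 2 := by
  rw [show sin (a + b) - sin a - b * cos a = sin a * (cos b - 1) + cos a * (sin b - b) by
    rw [sin_add]; ring]
  refine (abs_mul_add_mul_le (abs_sin_le_one a) (abs_cos_le_one a)
    (abs_cos_sub_one_le b) (abs_sin_sub_self_le b)).trans_eq (by ring)

lemma norm_wave_le_waveNorm {N : ℕ} (p ξ : Fin N → E3) (θ : ℝ) (k : E3) :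
    ‖wave p ξ θ k‖ ≤ 2 * waveNorm p ξ k := by
  rw [wave_eq]
  refine (norm_smul_add_smul_wave_le _ _ _ _ _).trans ?_
  gcongr
  · exact waveNorm_nonneg _ _ _
  · linarith [abs_cos_le_one θ, abs_sin_le_one θ]

lemma norm_wave_add_sub_le {N : ℕ} (p ξ : Fin N → E3) (θ b : ℝ) (k : E3) :
    ‖wave p ξ (θ + b) k - wave p ξ θ k‖ ≤ 2 * |b| * waveNorm p ξ k := by
  rw [wave_eq, wave_eq p ξ θ, add_sub_add_comm, ← sub_smul, ← sub_smul]
  refine (norm_smul_add_smul_wave_le _ _ _ _ _).trans ?_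
  gcongr
  · exact waveNorm_nonneg _ _ _
  · have hc := abs_cos_sub_cos_le (θ + b) θ
    have hs := abs_sin_sub_sin_le (θ + b) θ
    rw [add_sub_cancel_left] at hc hs
    linarith

lemma norm_wave_taylor_le {N : ℕ} (p ξ : Fin N → E3) (θ b : ℝ) (k : E3) :
    ‖wave p ξ (θ + b) k - wave p ξ θ k - b • wave p ξ (θ + π / 2) k‖ ≤
      6 * b ^ 2 * waveNorm p ξ k := by
  rw [wave_eq, wave_eq p ξ θ, wave_eq p ξ (θ + π / 2), cos_add_pi_div_two, sin_add_pi_div_two,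
    smul_add, smul_smul, smul_smul, add_sub_add_comm, add_sub_add_comm, ← sub_smul, ← sub_smul,
    ← sub_smul, ← sub_smul]
  refine (norm_smul_add_smul_wave_le _ _ _ _ _).trans ?_
  gcongr
  · exact waveNorm_nonneg _ _ _
  · linarith [abs_cos_add_taylor_le θ b, abs_sin_add_taylor_le θ b]

/-! ### Integral representations and bounds by the energy -/

/-- The derivative `∑ α, ⟨∇φ(q - p α), v⟩ ξ α` of `discPsi` at `q` in the direction `v`. -/
def discPsiDeriv (φ : E3 → ℝ) {N : ℕ} (p ξ : Fin N → E3) (q v : E3) : E3 :=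
  ∑ α, (inner ℝ (gradient φ (q - p α)) v : ℝ) • ξ α

section Spectral

variable {φ : E3 → ℝ} {μ : Measure E3} {N : ℕ}

lemma two_mul_discEnergy (hμ : ∀ n : ℕ, Integrable (fun k => ‖k‖ ^ n) μ)
    (hφ : ∀ x, φ x = ∫ k, cos (inner ℝ k x) ∂μ) (p ξ : Fin N → E3) :
    2 * discEnergy φ p ξ = ∫ k, waveNorm p ξ k ^ 2 ∂μ := by
  have hsq : ∀ k, waveNorm p ξ k ^ 2 =
      ∑ α, ∑ β, cos (inner ℝ k (p α - p β)) * (inner ℝ (ξ α) (ξ β) : ℝ) := by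
    intro k
    rw [waveNorm_sq, ← real_inner_self_eq_norm_sq, ← real_inner_self_eq_norm_sq]
    simp only [wave, sum_inner, inner_sum, ← Finset.sum_add_distrib, real_inner_smul_left,
      real_inner_smul_right, zero_sub, cos_neg, cos_pi_div_two_sub, inner_sub_right]
    refine Finset.sum_congr rfl fun α _ => Finset.sum_congr rfl fun β _ => ?_
    rw [cos_sub, real_inner_comm (ξ α)]
    ring
  simp_rw [hsq]
  rw [integral_finsetSum _ fun α _ => integrable_finsetSum _ fun β _ =>
    (integrable_cos_inner hμ _).mul_const _]
  rw [discEnergy, ← mul_assoc, mul_one_div_cancel two_ne_zero, one_mul]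
  refine Finset.sum_congr rfl fun α _ => ?_
  rw [integral_finsetSum _ fun β _ => (integrable_cos_inner hμ _).mul_const _]
  refine Finset.sum_congr rfl fun β _ => ?_
  rw [integral_mul_const, hφ]

lemma discPsi_eq_integral (hμ : ∀ n : ℕ, Integrable (fun k => ‖k‖ ^ n) μ)
    (hφ : ∀ x, φ x = ∫ k, cos (inner ℝ k x) ∂μ) (p ξ : Fin N → E3) (q : E3) :
    discPsi φ p ξ q = ∫ k, wave p ξ (inner ℝ k q) k ∂μ := by
  simp only [wave, ← inner_sub_right]
  rw [integral_finsetSum _ fun α _ => (integrable_cos_inner hμ _).smul_const _]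
  refine Finset.sum_congr rfl fun α _ => ?_
  rw [integral_smul_const, hφ]

lemma discVel_eq_integral (hμ : ∀ n : ℕ, Integrable (fun k => ‖k‖ ^ n) μ)
    (hφ : ∀ x, φ x = ∫ k, cos (inner ℝ k x) ∂μ) (p ξ : Fin N → E3) (q : E3) :
    discVel φ p ξ q = ∫ k, cross3 k (wave p ξ (inner ℝ k q + π / 2) k) ∂μ := by
  simp only [wave_add_pi_div_two, cross3_sum_right, cross3_smul_right, ← cross3_smul_left,
    ← inner_sub_right]
  simp only [← crossRight_apply]
  rw [integral_finsetSum _ fun α _ =>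
    (crossRight (ξ α)).integrable_comp (integrable_sin_inner_smul hμ _)]
  refine Finset.sum_congr rfl fun α _ => ?_
  rw [gradient_eq_integral hμ hφ]
  exact ((crossRight (ξ α)).integral_comp_comm (integrable_sin_inner_smul hμ _)).symm

lemma discPsiDeriv_eq_integral (hμ : ∀ n : ℕ, Integrable (fun k => ‖k‖ ^ n) μ)
    (hφ : ∀ x, φ x = ∫ k, cos (inner ℝ k x) ∂μ) (p ξ : Fin N → E3) (q v : E3) :
    discPsiDeriv φ p ξ q v =
      ∫ k, (inner ℝ k v : ℝ) • wave p ξ (inner ℝ k q + π / 2) k ∂μ := by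
  have hint : ∀ x, Integrable (fun k : E3 => (inner ℝ k v : ℝ) * -sin (inner ℝ k x)) μ := by
    intro x
    refine ((integrable_sin_inner_smul hμ x).inner_const (𝕜 := ℝ) v).congr
      (.of_forall fun k => ?_)
    simp only [real_inner_smul_left]
    ring
  simp only [wave_add_pi_div_two, Finset.smul_sum, smul_smul, ← inner_sub_right]
  rw [integral_finsetSum _ fun α _ => (hint _).smul_const _]
  refine Finset.sum_congr rfl fun α _ => ?_
  rw [gradient_eq_integral hμ hφ, integral_smul_const, real_inner_comm,
    ← integral_inner (integrable_sin_inner_smul hμ _)]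
  congr 1
  refine integral_congr_ae (.of_forall fun k => ?_)
  simp only [real_inner_smul_right, real_inner_comm v k]
  ring

lemma integrable_waveNorm_mul (hμ : ∀ n : ℕ, Integrable (fun k => ‖k‖ ^ n) μ)
    (p ξ : Fin N → E3) (n : ℕ) : Integrable (fun k => ‖k‖ ^ n * waveNorm p ξ k) μ := by
  have hcont := continuous_waveNorm p ξ
  refine integrable_of_norm_le_mul_pow hμ (by fun_prop) √(2 * discLength ξ ^ 2) n fun k => ?_
  rw [Real.norm_of_nonneg (mul_nonneg (by positivity) (waveNorm_nonneg _ _ _)), mul_comm]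
  gcongr
  exact le_sqrt_of_sq_le (waveNorm_sq_le p ξ k)

/-- Cauchy–Schwarz: an integrand dominated by `‖k‖ ^ n` times the Fourier modes of the
configuration has integral controlled by the square root of the energy. -/
lemma norm_integral_le_sqrt_energy (hμ : ∀ n : ℕ, Integrable (fun k => ‖k‖ ^ n) μ)
    (hφ : ∀ x, φ x = ∫ k, cos (inner ℝ k x) ∂μ) (p ξ : Fin N → E3) {f : E3 → E3} (n : ℕ)
    {B : ℝ} (hB : 0 ≤ B) (hf : ∀ k, ‖f k‖ ≤ B * (‖k‖ ^ n * waveNorm p ξ k)) :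
    ‖∫ k, f k ∂μ‖ ≤ B * (√(∫ k, ‖k‖ ^ (2 * n) ∂μ) * √(2 * discEnergy φ p ξ)) := by
  refine (norm_integral_le_of_norm_le ((integrable_waveNorm_mul hμ p ξ n).const_mul B)
    (.of_forall hf)).trans ?_
  rw [integral_const_mul]
  gcongr
  have hcont := continuous_waveNorm p ξ
  have hL2 : MemLp (waveNorm p ξ) (ENNReal.ofReal 2) μ := by
    rw [ENNReal.ofReal_ofNat, memLp_two_iff_integrable_sq hcont.aestronglyMeasurable]
    refine integrable_of_norm_le_mul_pow hμ (by fun_prop) (2 * discLength ξ ^ 2) 0 fun k => ?_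
    rw [Real.norm_of_nonneg (sq_nonneg _), pow_zero, mul_one]
    exact waveNorm_sq_le p ξ k
  have hpow : MemLp (fun k : E3 => ‖k‖ ^ n) (ENNReal.ofReal 2) μ := by
    rw [ENNReal.ofReal_ofNat, memLp_two_iff_integrable_sq
      (Continuous.aestronglyMeasurable (by fun_prop))]
    simpa only [← pow_mul, mul_comm n 2] using hμ (2 * n)
  have h := integral_mul_le_Lp_mul_Lq_of_nonneg (μ := μ) Real.HolderConjugate.two_two
    (.of_forall fun k => by positivity) (.of_forall (waveNorm_nonneg p ξ)) hpow hL2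
  rw [two_mul_discEnergy hμ hφ, sqrt_eq_rpow, sqrt_eq_rpow]
  simpa only [rpow_ofNat, ← pow_mul, mul_comm n 2] using h

lemma integrable_wave (hμ : ∀ n : ℕ, Integrable (fun k => ‖k‖ ^ n) μ) (p ξ : Fin N → E3)
    {θ : E3 → ℝ} (hθ : Continuous θ) : Integrable (fun k => wave p ξ (θ k) k) μ :=
  integrable_of_norm_le_mul_pow hμ (continuous_wave p ξ hθ) (discLength ξ) 0 fun k => by
    simpa using norm_wave_le p ξ (θ k) k

lemma integrable_cross3_wave (hμ : ∀ n : ℕ, Integrable (fun k => ‖k‖ ^ n) μ)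
    (p ξ : Fin N → E3) {θ : E3 → ℝ} (hθ : Continuous θ) :
    Integrable (fun k => cross3 k (wave p ξ (θ k) k)) μ := by
  have hcont : Continuous fun k => cross3 k (wave p ξ (θ k) k) := by
    have hright : ∀ b, Continuous fun k => cross3 k b := fun b => (crossRight b).continuous
    simp only [wave, cross3_sum_right, cross3_smul_right]
    fun_prop
  refine integrable_of_norm_le_mul_pow hμ hcont (discLength ξ) 1 fun k => ?_
  rw [pow_one, mul_comm]
  exact (norm_cross3_le _ _).trans (by gcongr; exact norm_wave_le p ξ _ k)

lemma integrable_inner_smul_wave (hμ : ∀ n : ℕ, Integrable (fun k => ‖k‖ ^ n) μ)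
    (p ξ : Fin N → E3) {θ : E3 → ℝ} (hθ : Continuous θ) (v : E3) :
    Integrable (fun k => (inner ℝ k v : ℝ) • wave p ξ (θ k) k) μ := by
  have hcont := continuous_wave p ξ hθ
  refine integrable_of_norm_le_mul_pow hμ (by fun_prop) (‖v‖ * discLength ξ) 1 fun k => ?_
  rw [norm_smul, pow_one, mul_right_comm, mul_comm ‖v‖]
  gcongr
  · exact norm_inner_le_norm k v
  · exact norm_wave_le p ξ _ k

lemma norm_discVel_le (hμ : ∀ n : ℕ, Integrable (fun k => ‖k‖ ^ n) μ)
    (hφ : ∀ x, φ x = ∫ k, cos (inner ℝ k x) ∂μ) (p ξ : Fin N → E3) (q : E3) :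
    ‖discVel φ p ξ q‖ ≤ 2 * (√(∫ k, ‖k‖ ^ 2 ∂μ) * √(2 * discEnergy φ p ξ)) := by
  rw [discVel_eq_integral hμ hφ]
  refine norm_integral_le_sqrt_energy hμ hφ p ξ 1 zero_le_two fun k => ?_
  refine (norm_cross3_le _ _).trans ?_
  nlinarith [norm_wave_le_waveNorm p ξ (inner ℝ k q + π / 2) k, norm_nonneg k]

lemma norm_discVel_sub_le (hμ : ∀ n : ℕ, Integrable (fun k => ‖k‖ ^ n) μ)
    (hφ : ∀ x, φ x = ∫ k, cos (inner ℝ k x) ∂μ) (p ξ : Fin N → E3) (q v : E3) :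
    ‖discVel φ p ξ (q + v) - discVel φ p ξ q‖ ≤
      2 * ‖v‖ * (√(∫ k, ‖k‖ ^ 4 ∂μ) * √(2 * discEnergy φ p ξ)) := by
  rw [discVel_eq_integral hμ hφ, discVel_eq_integral hμ hφ, ← integral_sub
    (integrable_cross3_wave hμ p ξ (by fun_prop)) (integrable_cross3_wave hμ p ξ (by fun_prop))]
  refine norm_integral_le_sqrt_energy hμ hφ p ξ 2 (by positivity) fun k => ?_
  rw [← cross3_sub_right, inner_add_right, add_right_comm]
  refine (norm_cross3_le _ _).trans ?_
  have hZ := waveNorm_nonneg p ξ k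
  calc ‖k‖ * ‖wave p ξ (inner ℝ k q + π / 2 + inner ℝ k v) k - wave p ξ (inner ℝ k q + π / 2) k‖
      ≤ ‖k‖ * (2 * (‖k‖ * ‖v‖) * waveNorm p ξ k) := by
        gcongr
        refine (norm_wave_add_sub_le _ _ _ _ _).trans ?_
        gcongr
        exact abs_real_inner_le_norm k v
    _ = 2 * ‖v‖ * (‖k‖ ^ 2 * waveNorm p ξ k) := by ring

lemma norm_discPsi_sub_le (hμ : ∀ n : ℕ, Integrable (fun k => ‖k‖ ^ n) μ)
    (hφ : ∀ x, φ x = ∫ k, cos (inner ℝ k x) ∂μ) (p ξ : Fin N → E3) (q v : E3) :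
    ‖discPsi φ p ξ (q + v) - discPsi φ p ξ q‖ ≤
      2 * ‖v‖ * (√(∫ k, ‖k‖ ^ 2 ∂μ) * √(2 * discEnergy φ p ξ)) := by
  rw [discPsi_eq_integral hμ hφ, discPsi_eq_integral hμ hφ, ← integral_sub
    (integrable_wave hμ p ξ (by fun_prop)) (integrable_wave hμ p ξ (by fun_prop))]
  refine norm_integral_le_sqrt_energy hμ hφ p ξ 1 (by positivity) fun k => ?_
  rw [inner_add_right]
  have hZ := waveNorm_nonneg p ξ k
  refine (norm_wave_add_sub_le _ _ _ _ _).trans ?_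
  calc 2 * |inner ℝ k v| * waveNorm p ξ k ≤ 2 * (‖k‖ * ‖v‖) * waveNorm p ξ k := by
        gcongr
        exact abs_real_inner_le_norm k v
    _ = 2 * ‖v‖ * (‖k‖ ^ 1 * waveNorm p ξ k) := by ring

lemma norm_discPsi_taylor_le (hμ : ∀ n : ℕ, Integrable (fun k => ‖k‖ ^ n) μ)
    (hφ : ∀ x, φ x = ∫ k, cos (inner ℝ k x) ∂μ) (p ξ : Fin N → E3) (q v : E3) :
    ‖discPsi φ p ξ (q + v) - discPsi φ p ξ q - discPsiDeriv φ p ξ q v‖ ≤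
      6 * ‖v‖ ^ 2 * (√(∫ k, ‖k‖ ^ 4 ∂μ) * √(2 * discEnergy φ p ξ)) := by
  have hint : ∀ x : E3, Integrable (fun k => wave p ξ (inner ℝ k x) k) μ := fun x =>
    integrable_wave hμ p ξ (by fun_prop)
  have hsub : Integrable
      (fun k => wave p ξ (inner ℝ k (q + v)) k - wave p ξ (inner ℝ k q) k) μ :=
    (hint _).sub (hint _)
  rw [discPsi_eq_integral hμ hφ, discPsi_eq_integral hμ hφ, discPsiDeriv_eq_integral hμ hφ,
    ← integral_sub (hint _) (hint _), ← integral_sub hsub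
    (integrable_inner_smul_wave hμ p ξ (by fun_prop) v)]
  refine norm_integral_le_sqrt_energy hμ hφ p ξ 2 (by positivity) fun k => ?_
  rw [inner_add_right]
  have hZ := waveNorm_nonneg p ξ k
  refine (norm_wave_taylor_le _ _ _ _ _).trans ?_
  calc 6 * (inner ℝ k v) ^ 2 * waveNorm p ξ k ≤ 6 * (‖k‖ * ‖v‖) ^ 2 * waveNorm p ξ k := by
        gcongr 6 * ?_ * _
        rw [← sq_abs]
        gcongr
        exact abs_real_inner_le_norm k v
    _ = 6 * ‖v‖ ^ 2 * (‖k‖ ^ 2 * waveNorm p ξ k) := by ring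

end Spectral

/-! ### The rate of change of the energy -/

section Rate

variable {φ : E3 → ℝ} {N : ℕ}

lemma gradient_neg_of_even (heven : ∀ x, φ (-x) = φ x) (x : E3) :
    gradient φ (-x) = -gradient φ x := by
  have h : fderiv ℝ φ (-x) = -fderiv ℝ φ x := by
    have hcomp := (ContinuousLinearEquiv.neg ℝ (M := E3)).comp_right_fderiv (f := φ) (x := x)
    have hfun : φ ∘ ContinuousLinearEquiv.neg ℝ (M := E3) = φ := funext heven
    rw [hfun] at hcomp
    rw [hcomp]
    ext v
    simp
  rw [gradient, gradient, h, map_neg]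

/-- Differentiation of the energy along moving configurations. -/
lemma hasDerivAt_discEnergy (hφ : Differentiable ℝ φ) (heven : ∀ x, φ (-x) = φ x)
    {x ξ : Fin N → ℝ → E3} {V d : Fin N → E3} {t : ℝ} (hx : ∀ α, HasDerivAt (x α) (V α) t)
    (hξ : ∀ α, HasDerivAt (ξ α) (d α) t) :
    HasDerivAt (fun s => discEnergy φ (fun β => x β s) (fun β => ξ β s))
      (∑ α, (inner ℝ (d α) (discPsi φ (fun β => x β t) (fun β => ξ β t) (x α t)) +
        inner ℝ (ξ α t)
          (discPsiDeriv φ (fun β => x β t) (fun β => ξ β t) (x α t) (V α)))) t := by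
  have hterm : ∀ α β, HasDerivAt
      (fun s => φ (x α s - x β s) * (inner ℝ (ξ α s) (ξ β s) : ℝ))
      (inner ℝ (gradient φ (x α t - x β t)) (V α - V β) * inner ℝ (ξ α t) (ξ β t) +
        φ (x α t - x β t) * (inner ℝ (ξ α t) (d β) + inner ℝ (d α) (ξ β t))) t := by
    intro α β
    have h := (hφ (x α t - x β t)).hasGradientAt.hasFDerivAt.comp_hasDerivAt t
      ((hx α).sub (hx β))
    exact h.mul ((hξ α).inner ℝ (hξ β))
  have hsum := (HasDerivAt.fun_sum (u := Finset.univ) fun α _ =>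
    HasDerivAt.fun_sum (u := Finset.univ) fun β _ => hterm α β).const_mul (1 / 2 : ℝ)
  refine hsum.congr_deriv ?_
  set F : Fin N → Fin N → ℝ := fun α β =>
    inner ℝ (d α) (φ (x α t - x β t) • ξ β t) +
      inner ℝ (ξ α t) ((inner ℝ (gradient φ (x α t - x β t)) (V α) : ℝ) • ξ β t) with hF
  have hsplit : ∀ α β, inner ℝ (gradient φ (x α t - x β t)) (V α - V β) *
        inner ℝ (ξ α t) (ξ β t) +
      φ (x α t - x β t) * (inner ℝ (ξ α t) (d β) + inner ℝ (d α) (ξ β t)) =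
      F α β + F β α := by
    intro α β
    have hneg : x β t - x α t = -(x α t - x β t) := (neg_sub _ _).symm
    simp only [hF, hneg, heven, gradient_neg_of_even heven, real_inner_smul_right,
      inner_sub_right, inner_neg_left, real_inner_comm (ξ α t) (ξ β t),
      real_inner_comm (d β) (ξ α t)]
    ring
  simp only [hsplit, Finset.sum_add_distrib]
  rw [Finset.sum_comm (f := fun α β => F β α), ← Finset.sum_add_distrib]
  simp only [hF, discPsi, discPsiDeriv, inner_sum, Finset.sum_add_distrib]
  ring

/-- The antisymmetric part of the derivative of `discPsi` is the cross product with its curl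
`discVel`, and so disappears when one argument is `discVel` itself. -/
lemma inner_discPsiDeriv_discVel (p ξ : Fin N → E3) (q w : E3) :
    inner ℝ w (discPsiDeriv φ p ξ q (discVel φ p ξ q)) =
      inner ℝ (discVel φ p ξ q) (discPsiDeriv φ p ξ q w) := by
  set v := discVel φ p ξ q with hv
  have h : inner ℝ v (cross3 v w) = 0 := inner_self_cross3 v w
  rw [hv, discVel, sum_inner, ← discVel, ← hv] at h
  simp only [inner_cross3_cross3, Finset.sum_sub_distrib] at h
  simp only [discPsiDeriv, inner_sum, real_inner_smul_right]
  simp only [real_inner_comm (ξ _)]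
  linarith

end Rate

/-- Energy rate bound for the discrete filament model
(`ξ_α = x_{α+1} − x_α` with cyclic indices, `ẋ_α = u_t(x_α)`):
`|dH/dt| ≤ c₁ H A + c₂ H^{1/2} A`, with `c₁, c₂` depending only on `φ`. -/
theorem discrete_filament_energy_rate (φ φhat : E3 → ℝ) (hA : HypA φ φhat)
    (hsm : ContDiff ℝ (⊤ : ℕ∞) φ)
    (hmom : ∀ n : ℕ, Integrable (fun k : E3 => ‖k‖ ^ (2 * n) * φhat k)) :
    ∃ c₁ c₂ : ℝ, 0 < c₁ ∧ 0 < c₂ ∧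
      ∀ (N : ℕ), 0 < N → ∀ (T : ℝ), 0 < T → ∀ x : Fin N → ℝ → E3,
        (∀ α, ContDiff ℝ 1 (x α)) →
        (∀ t ∈ Icc (0:ℝ) T, ∀ α,
          HasDerivAt (x α)
            (discVel φ (fun β => x β t)
              (fun β => x (finRotate N β) t - x β t) (x α t)) t) →
        ∀ t ∈ Icc (0:ℝ) T, ∃ h' : ℝ,
          HasDerivAt
            (fun s => discEnergy φ (fun β => x β s)
              (fun β => x (finRotate N β) s - x β s)) h' t ∧
          |h'| ≤
            c₁ * discEnergy φ (fun β => x β t) (fun β => x (finRotate N β) t - x β t) *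
                discQuad (fun β => x (finRotate N β) t - x β t) +
              c₂ * Real.sqrt (discEnergy φ (fun β => x β t)
                  (fun β => x (finRotate N β) t - x β t)) *
                discQuad (fun β => x (finRotate N β) t - x β t) := by
  obtain ⟨μ, -, hμ, hφ⟩ := exists_spectralMeasure hA hmom
  set M₂ := √(∫ k : E3, ‖k‖ ^ 2 ∂μ)
  set M₄ := √(∫ k : E3, ‖k‖ ^ 4 ∂μ)
  refine ⟨32 * (M₂ * M₄) + 1, 1, by positivity, one_pos, fun N _ T _ x _ hx t ht => ?_⟩
  set p : Fin N → E3 := fun β => x β t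
  set ξ : Fin N → E3 := fun β => x (finRotate N β) t - x β t
  set V : Fin N → E3 := fun α => discVel φ p ξ (p α)
  refine ⟨_, hasDerivAt_discEnergy (hsm.differentiable (by simp)) hA.even (hx t ht)
    (fun α => (hx t ht (finRotate N α)).sub (hx t ht α)), ?_⟩
  have hnonneg : 0 ≤ 2 * discEnergy φ p ξ := by
    rw [two_mul_discEnergy hμ hφ]
    exact integral_nonneg fun k => sq_nonneg _
  have hstep : ∀ α, p (finRotate N α) = p α + ξ α := fun α => (add_sub_cancel _ _).symm
  have hshift : ∑ α, inner ℝ (V (finRotate N α)) (discPsi φ p ξ (p (finRotate N α))) =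
      ∑ α, inner ℝ (V α) (discPsi φ p ξ (p α)) :=
    Equiv.sum_comp (finRotate N) fun α => inner ℝ (V α) (discPsi φ p ξ (p α))
  have hrate : ∑ α, (inner ℝ (V (finRotate N α) - V α) (discPsi φ p ξ (p α)) +
        inner ℝ (ξ α) (discPsiDeriv φ p ξ (p α) (V α))) =
      ∑ α, (-inner ℝ (V α)
          (discPsi φ p ξ (p α + ξ α) - discPsi φ p ξ (p α) - discPsiDeriv φ p ξ (p α) (ξ α)) -
        inner ℝ (discVel φ p ξ (p α + ξ α) - V α)
          (discPsi φ p ξ (p α + ξ α) - discPsi φ p ξ (p α))) := by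
    rw [← sub_eq_zero, ← sub_eq_zero.2 hshift, ← Finset.sum_sub_distrib,
      ← Finset.sum_sub_distrib]
    refine Finset.sum_congr rfl fun α _ => ?_
    rw [inner_discPsiDeriv_discVel, ← hstep]
    simp only [V, inner_sub_left, inner_sub_right]
    ring
  have hbound : |∑ α, (inner ℝ (V (finRotate N α) - V α) (discPsi φ p ξ (p α)) +
        inner ℝ (ξ α) (discPsiDeriv φ p ξ (p α) (V α)))| ≤
      32 * (M₂ * M₄) * discEnergy φ p ξ * discQuad ξ := by
    rw [hrate, discQuad, Finset.mul_sum]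
    refine (Finset.abs_sum_le_sum_abs _ _).trans (Finset.sum_le_sum fun α _ => ?_)
    refine (abs_sub _ _).trans ?_
    rw [abs_neg]
    have h₁ := (abs_real_inner_le_norm _ _).trans (mul_le_mul
      (norm_discVel_le hμ hφ p ξ (p α)) (norm_discPsi_taylor_le hμ hφ p ξ (p α) (ξ α))
      (norm_nonneg _) (by positivity))
    have h₂ := (abs_real_inner_le_norm _ _).trans (mul_le_mul
      (norm_discVel_sub_le hμ hφ p ξ (p α) (ξ α)) (norm_discPsi_sub_le hμ hφ p ξ (p α) (ξ α))
      (norm_nonneg _) (by positivity))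
    refine (add_le_add h₁ h₂).trans_eq ?_
    have hsq := mul_self_sqrt hnonneg
    linear_combination 16 * M₂ * M₄ * ‖ξ α‖ ^ 2 * hsq
  have hquad : 0 ≤ discQuad ξ := Finset.sum_nonneg fun α _ => sq_nonneg _
  refine hbound.trans ?_
  have h₁ : 0 ≤ discEnergy φ p ξ * discQuad ξ := mul_nonneg (by linarith) hquad
  have h₂ : 0 ≤ √(discEnergy φ p ξ) * discQuad ξ := by positivity
  linarith
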